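/- arXiv:0705.3137 — 6 statements merged into one kernel-verified Lean document; each statement's English description precedes it below -/
import Mathlib

section
/- Let α = (α0,α1,α2,α3,α4,α5,α6) ∈ ℂ^7 satisfy 3α0+α1+2α2+α3+2α4+2α5+α6 = 0, and let q,p : ℝ → ℂ be differentiable with p(t) ≠ 0 for all t, satisfying q'(t) = ∂I/∂p(q(t),p(t);α) and p'(t) = −∂I/∂q(q(t),p(t);α). Define q̃(t) = q(t) + α0/p(t), p̃(t) = p(t), and α̃ = (−α0, α1, α0+α2, α3, α4+α0, α5+α0, α6). Then α̃ satisfies 3α̃0+α̃1+2α̃2+α̃3+2α̃4+2α̃5+α̃6 = 0 and q̃'(t) = ∂I/∂p(q̃(t),p̃(t);α̃), p̃'(t) = −∂I/∂q(q̃(t),p̃(t);α̃) for all t; that is, s0 is a Bäcklund transformation of the system. -/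
/-- The polynomial Hamiltonian `I(q,p;α)` of the second-order polynomial
Hamiltonian system with extended affine Weyl group symmetry of type `E₆⁽¹⁾`. -/
noncomputable def hamI (a0 a1 a2 a3 a4 a5 a6 q p : ℂ) : ℂ :=
  (q - 1)^2 * q^2 * p^3
  - q * (q - 1) * ((a1 + 2*a2 + a3 + 2*a4) * q - a1 - 2*a2) * p^2
  + ((-3*a0^2 - 2*a0*(a1 + 2*a2 + a3 + 2*a4) - 3*a0*a5
      - a5*(a1 + 2*a2 + a3 + 2*a4 + a5)) * q^2
     + (-3*a0^2 - a2^2 + 2*a0*(a1 + 2*a2 + a3 + 2*a4) + 3*a0*a5 + 2*a2*a5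
        + a1*(a5 - a2) + (a4 + a5)*(a3 + a4 + a5)) * q
     + a2*(a1 + a2)) * p
  + a0*(a0 + a5)*(a0 + a5 + a6) * q

/-- The partial derivative `∂I/∂p`. -/
noncomputable def hamIp (a0 a1 a2 a3 a4 a5 a6 q p : ℂ) : ℂ :=
  deriv (fun x => hamI a0 a1 a2 a3 a4 a5 a6 q x) p

/-- The partial derivative `∂I/∂q`. -/
noncomputable def hamIq (a0 a1 a2 a3 a4 a5 a6 q p : ℂ) : ℂ :=
  deriv (fun x => hamI a0 a1 a2 a3 a4 a5 a6 x p) q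

theorem hamIp_eq (a0 a1 a2 a3 a4 a5 a6 q p : ℂ) : hamIp a0 a1 a2 a3 a4 a5 a6 q p =
  3 * ((q - 1)^2 * q^2) * p^2
  - 2 * (q * (q - 1) * ((a1 + 2*a2 + a3 + 2*a4) * q - a1 - 2*a2)) * p
  + ((-3*a0^2 - 2*a0*(a1 + 2*a2 + a3 + 2*a4) - 3*a0*a5
      - a5*(a1 + 2*a2 + a3 + 2*a4 + a5)) * q^2
     + (-3*a0^2 - a2^2 + 2*a0*(a1 + 2*a2 + a3 + 2*a4) + 3*a0*a5 + 2*a2*a5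
        + a1*(a5 - a2) + (a4 + a5)*(a3 + a4 + a5)) * q
     + a2*(a1 + a2)) := by
  unfold hamIp hamI
  have aux : ∀ A B C D : ℂ, deriv (fun x : ℂ => A * x^3 - B * x^2 + C * x + D) p
      = 3 * A * p^2 - 2 * B * p + C := by
    intro A B C D
    have hx := hasDerivAt_id' p
    have h := ((((hx.fun_pow 3).const_mul A).fun_sub ((hx.fun_pow 2).const_mul B)).fun_add
      (hx.const_mul C)).add_const D
    rw [h.deriv]
    push_cast
    ring
  exact aux _ _ _ _

theorem hamIq_eq (a0 a1 a2 a3 a4 a5 a6 q p : ℂ) : hamIq a0 a1 a2 a3 a4 a5 a6 q p =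
  (4 * q^3 - 6 * q^2 + 2 * q) * p^3
  - (3 * (a1 + 2*a2 + a3 + 2*a4) * q^2
      - 2 * ((a1 + 2*a2 + a3 + 2*a4) + a1 + 2*a2) * q + (a1 + 2*a2)) * p^2
  + (2 * (-3*a0^2 - 2*a0*(a1 + 2*a2 + a3 + 2*a4) - 3*a0*a5
      - a5*(a1 + 2*a2 + a3 + 2*a4 + a5)) * q
     + (-3*a0^2 - a2^2 + 2*a0*(a1 + 2*a2 + a3 + 2*a4) + 3*a0*a5 + 2*a2*a5
        + a1*(a5 - a2) + (a4 + a5)*(a3 + a4 + a5))) * p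
  + a0*(a0 + a5)*(a0 + a5 + a6) := by
  unfold hamIq hamI
  have aux : ∀ S T C D E G : ℂ, deriv (fun x : ℂ => (x - 1)^2 * x^2 * p^3
      - x * (x - 1) * (S * x - a1 - T) * p^2 + (C * x^2 + D * x + E) * p + G * x) q
      = (4 * q^3 - 6 * q^2 + 2 * q) * p^3
        - (3 * S * q^2 - 2 * (S + a1 + T) * q + (a1 + T)) * p^2
        + (2 * C * q + D) * p + G := by
    intro S T C D E G
    have e : (fun x : ℂ => (x - 1)^2 * x^2 * p^3
      - x * (x - 1) * (S * x - a1 - T) * p^2 + (C * x^2 + D * x + E) * p + G * x)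
      = fun x : ℂ => p^3 * x^4 + (-2 * p^3 - S * p^2) * x^3
        + (p^3 + (S + a1 + T) * p^2 + C * p) * x^2
        + (-(a1 + T) * p^2 + D * p + G) * x + E * p := by
      funext x
      ring
    have hx := hasDerivAt_id' q
    have h := (((((hx.fun_pow 4).const_mul (p^3)).fun_add
      ((hx.fun_pow 3).const_mul (-2 * p^3 - S * p^2))).fun_add
      ((hx.fun_pow 2).const_mul (p^3 + (S + a1 + T) * p^2 + C * p))).fun_add
      (hx.const_mul (-(a1 + T) * p^2 + D * p + G))).add_const (E * p)
    rw [e, h.deriv]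
    push_cast
    ring
  exact aux _ _ _ _ _ _

/-- `s₀ : (q,p;α) ↦ (q + α₀/p, p; -α₀, α₁, α₀+α₂, α₃, α₄+α₀, α₅+α₀, α₆)`
is a Bäcklund transformation of the Hamiltonian system for `I`. -/
theorem statement1 (a0 a1 a2 a3 a4 a5 a6 : ℂ)
    (hα : 3*a0 + a1 + 2*a2 + a3 + 2*a4 + 2*a5 + a6 = 0)
    (q p : ℝ → ℂ) (hp0 : ∀ t : ℝ, p t ≠ 0)
    (hq : ∀ t : ℝ, HasDerivAt q (hamIp a0 a1 a2 a3 a4 a5 a6 (q t) (p t)) t)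
    (hp : ∀ t : ℝ, HasDerivAt p (-(hamIq a0 a1 a2 a3 a4 a5 a6 (q t) (p t))) t) :
    (3*(-a0) + a1 + 2*(a0 + a2) + a3 + 2*(a4 + a0) + 2*(a5 + a0) + a6 = 0) ∧
    ∀ t : ℝ,
      HasDerivAt (fun s => q s + a0 / p s)
        (hamIp (-a0) a1 (a0 + a2) a3 (a4 + a0) (a5 + a0) a6
          (q t + a0 / p t) (p t)) t ∧
      HasDerivAt p
        (-(hamIq (-a0) a1 (a0 + a2) a3 (a4 + a0) (a5 + a0) a6
          (q t + a0 / p t) (p t))) t := by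
  have h6 : a6 = -(3*a0 + a1 + 2*a2 + a3 + 2*a4 + 2*a5) := by linear_combination hα
  refine ⟨by linear_combination hα, fun t => ⟨?_, ?_⟩⟩
  · have h := (hq t).fun_add ((hasDerivAt_const t a0).fun_div (hp t) (hp0 t))
    refine h.congr_deriv ?_
    rw [hamIp_eq, hamIp_eq, hamIq_eq, h6]
    have := hp0 t
    field_simp
    ring
  · refine (hp t).congr_deriv ?_
    rw [hamIq_eq, hamIq_eq, h6]
    have := hp0 t
    field_simp
    ring
end

section
/- Let α = (α0,α1,α2,α3,α4,α5,α6) ∈ ℂ^7 satisfy 3α0+α1+2α2+α3+2α4+2α5+α6 = 0. Then there exists a polynomial P ∈ ℂ[X,Y] in two variables such that for all q,p ∈ ℂ with q ≠ 0 one has I(q,p;α) = P(1/q, −(q·p+α0)·q). (The Hamiltonian is polynomial in the coordinate chart r0 : x0 = 1/q, y0 = −(qp+α0)q.) -/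
/-- The Hamiltonian `I` is polynomial in the coordinate chart
`r₀ : x₀ = 1/q, y₀ = -(qp+α₀)q`. -/
theorem statement8 (a0 a1 a2 a3 a4 a5 a6 : ℂ)
    (hα : 3*a0 + a1 + 2*a2 + a3 + 2*a4 + 2*a5 + a6 = 0) :
    ∃ P : MvPolynomial (Fin 2) ℂ, ∀ q p : ℂ, q ≠ 0 →
      hamI a0 a1 a2 a3 a4 a5 a6 q p
        = MvPolynomial.eval ![1 / q, -(q * p + a0) * q] P := by
  -- coefficients of the Hamiltonian written in the variable u = q p
  obtain ⟨S, hS⟩ : ∃ S, S = a1 + 2*a2 + a3 + 2*a4 := ⟨_, rfl⟩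
  obtain ⟨T, hT⟩ : ∃ T, T = a1 + 2*a2 := ⟨_, rfl⟩
  obtain ⟨A, hA⟩ : ∃ A, A = -3*a0^2 - 2*a0*S - 3*a0*a5 - a5*(S + a5) := ⟨_, rfl⟩
  obtain ⟨B, hB⟩ : ∃ B, B = -3*a0^2 - a2^2 + 2*a0*S + 3*a0*a5 + 2*a2*a5
        + a1*(a5 - a2) + (a4 + a5)*(a3 + a4 + a5) := ⟨_, rfl⟩
  obtain ⟨C, hC⟩ : ∃ C, C = a2*(a1 + a2) := ⟨_, rfl⟩
  let x : MvPolynomial (Fin 2) ℂ := MvPolynomial.X 0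
  let y : MvPolynomial (Fin 2) ℂ := MvPolynomial.X 1
  let c : ℂ → MvPolynomial (Fin 2) ℂ := fun z => MvPolynomial.C z
  let u : MvPolynomial (Fin 2) ℂ := -(x * y + c a0)
  refine ⟨-y * (u^2 - u * c a0 + c a0^2 - c S * (u - c a0) + c A)
    + (x - c 2) * u^3 - (c T * x - c T - c S) * u^2 + (c B + c C * x) * u, ?_⟩
  intro q p hq
  have hham : hamI a0 a1 a2 a3 a4 a5 a6 q p = (q - 1)^2 * q^2 * p^3
      - q * (q - 1) * (S * q - T) * p^2 + (A * q^2 + B * q + C) * p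
      + a0 * (a0 + a5) * (a0 + a5 + a6) * q := by
    rw [hA, hB, hC, hS, hT]; unfold hamI; ring
  have h6 : a6 = -3*a0 - S - 2*a5 := by rw [hS]; linear_combination hα
  have hu : -(1 / q * (-(q * p + a0) * q) + a0) = q * p := by field_simp; ring
  rw [hham]
  simp only [x, y, c, u, map_add, map_sub, map_mul, map_neg, map_pow,
    MvPolynomial.eval_X, MvPolynomial.eval_C, Matrix.cons_val_zero, Matrix.cons_val_one, hu]
  rw [h6, hA]
  field_simp
  ring
end

section
/- Let α = (α0,α1,α2,α3,α4,α5,α6) ∈ ℂ^7 satisfy 3α0+α1+2α2+α3+2α4+2α5+α6 = 0. Then for each a ∈ {α5, α5+α6} there exists a polynomial P ∈ ℂ[X,Y] in two variables such that for all q,p ∈ ℂ with q ≠ 0 and with y0 := −(q·p+α0)·q ≠ 0, setting x0 := 1/q, one has I(q,p;α) = P(−(x0·y0 − a)·y0, 1/y0). (The Hamiltonian is polynomial in the coordinate charts r5 and r6 obtained by composing r0 with the further charts x = −(x0·y0 − a)·y0, y = 1/y0.) -/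
open MvPolynomial in
theorem chart_aux (a0 a1 a2 a3 a4 a5 a6 : ℂ)
    (hα : 3*a0 + a1 + 2*a2 + a3 + 2*a4 + 2*a5 + a6 = 0) (a b : ℂ)
    (hs : a + b = 2 * a5 + a6) (hm : a * b = a5 * (a5 + a6)) :
    ∃ P : MvPolynomial (Fin 2) ℂ, ∀ q p : ℂ, q ≠ 0 → -(q * p + a0) * q ≠ 0 →
      hamI a0 a1 a2 a3 a4 a5 a6 q p
        = MvPolynomial.eval
            ![-((1 / q) * (-(q * p + a0) * q) - a) * (-(q * p + a0) * q),
              1 / (-(q * p + a0) * q)] P := by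
  let w : MvPolynomial (Fin 2) ℂ := C a - X 0 * X 1
  let s : MvPolynomial (Fin 2) ℂ := -(w + C a0)
  refine ⟨X 0 * (w - C b) + s^3 * (w * X 1 - 2)
    - s^2 * (C (a1 + 2*a2) * (w * X 1) - C (a1 + 2*a2 + a3 + 2*a4) - C (a1 + 2*a2))
    + s * (C (-3*a0^2 - a2^2 + 2*a0*(a1 + 2*a2 + a3 + 2*a4) + 3*a0*a5 + 2*a2*a5
        + a1*(a5 - a2) + (a4 + a5)*(a3 + a4 + a5)) + C (a2*(a1 + a2)) * (w * X 1)), ?_⟩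
  intro q p hq hY
  have hx : (1 / q) * (-(q * p + a0) * q) = -(q * p + a0) := by field_simp
  rw [hx]
  have hw : eval ![-(-(q * p + a0) - a) * (-(q * p + a0) * q),
      1 / (-(q * p + a0) * q)] w = -(q * p + a0) := by
    simp only [w, map_sub, map_mul, eval_C, eval_X, Matrix.cons_val_zero, Matrix.cons_val_one]
    rw [mul_assoc, mul_one_div_cancel hY]
    ring
  have hwy : -(q * p + a0) * (1 / (-(q * p + a0) * q)) = 1 / q := by
    have h1 : -(q * p + a0) ≠ 0 := left_ne_zero_of_mul hY
    rw [mul_one_div, div_mul_eq_div_div, div_self h1]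
  have h2 : eval ![-(-(q * p + a0) - a) * (-(q * p + a0) * q),
      1 / (-(q * p + a0) * q)] (2 : MvPolynomial (Fin 2) ℂ) = 2 := map_ofNat _ 2
  simp only [s, map_sub, map_add, map_neg, map_pow, map_mul (eval _), eval_C, eval_X, hw, h2,
    Matrix.cons_val_zero, Matrix.cons_val_one, hwy]
  have h6 : a6 = -(3*a0 + a1 + 2*a2 + a3 + 2*a4 + 2*a5) := by linear_combination hα
  have hb : b = 2 * a5 + a6 - a := by linear_combination hs
  subst hb
  subst h6
  unfold hamI
  field_simp
  linear_combination (-(q * (q*p+a0) * q)) * hm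

/-- The Hamiltonian `I` is polynomial in the coordinate charts `r₅, r₆` obtained
by composing `r₀ : x₀ = 1/q, y₀ = -(qp+α₀)q` with
`x = -(x₀y₀ - a)y₀, y = 1/y₀` for `a = α₅` resp. `a = α₅+α₆`. -/
theorem statement10 (a0 a1 a2 a3 a4 a5 a6 : ℂ)
    (hα : 3*a0 + a1 + 2*a2 + a3 + 2*a4 + 2*a5 + a6 = 0) :
    ∀ a : ℂ, (a = a5 ∨ a = a5 + a6) →
    ∃ P : MvPolynomial (Fin 2) ℂ, ∀ q p : ℂ, q ≠ 0 → -(q * p + a0) * q ≠ 0 →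
      hamI a0 a1 a2 a3 a4 a5 a6 q p
        = MvPolynomial.eval
            ![-((1 / q) * (-(q * p + a0) * q) - a) * (-(q * p + a0) * q),
              1 / (-(q * p + a0) * q)] P := by
  rintro a (rfl | rfl)
  · exact chart_aux a0 a1 a2 a3 a4 a a6 hα a (a + a6) (by ring) (by ring)
  · exact chart_aux a0 a1 a2 a3 a4 a5 a6 hα (a5 + a6) a5 (by ring) (by ring)
end

section
/- Define the maps s0 and s2 on triples (q,p,α) ∈ ℂ × ℂ × ℂ^7 by s0(q,p;α0,...,α6) = (q + α0/p, p; −α0, α1, α0+α2, α3, α4+α0, α5+α0, α6) (defined when p ≠ 0) and s2(q,p;α0,...,α6) = (q, p − α2/q; α0+α2, α1+α2, −α2, α3, α4, α5, α6) (defined when q ≠ 0). Then (s0∘s2)³ is the identity wherever defined: for every (q,p,α) such that each of the six successive applications in s0∘s2∘s0∘s2∘s0∘s2 is well defined (at each application of s2 the current q-coordinate is nonzero, and at each application of s0 the current p-coordinate is nonzero), one has (s0∘s2)(s0∘s2)(s0∘s2)(q,p;α) = (q,p;α). (This is the braid relation (s0·s2)³ = 1 for adjacent nodes of the E6^(1)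 Dynkin diagram.) -/
/-- The Bäcklund transformation `s₀` of the polynomial Hamiltonian system with
`W(E₆⁽¹⁾)`-symmetry (defined when `p ≠ 0`):
`s₀(q,p;α₀,…,α₆) = (q + α₀/p, p; -α₀, α₁, α₀+α₂, α₃, α₄+α₀, α₅+α₀, α₆)`. -/
noncomputable def s0E6 (x : ℂ × ℂ × (Fin 7 → ℂ)) : ℂ × ℂ × (Fin 7 → ℂ) :=
  (x.1 + x.2.2 0 / x.2.1, x.2.1,
   ![-(x.2.2 0), x.2.2 1, x.2.2 0 + x.2.2 2, x.2.2 3,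
     x.2.2 4 + x.2.2 0, x.2.2 5 + x.2.2 0, x.2.2 6])

/-- The Bäcklund transformation `s₂` of the polynomial Hamiltonian system with
`W(E₆⁽¹⁾)`-symmetry (defined when `q ≠ 0`):
`s₂(q,p;α₀,…,α₆) = (q, p - α₂/q; α₀+α₂, α₁+α₂, -α₂, α₃, α₄, α₅, α₆)`. -/
noncomputable def s2E6 (x : ℂ × ℂ × (Fin 7 → ℂ)) : ℂ × ℂ × (Fin 7 → ℂ) :=
  (x.1, x.2.1 - x.2.2 2 / x.1,
   ![x.2.2 0 + x.2.2 2, x.2.2 1 + x.2.2 2, -(x.2.2 2), x.2.2 3,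
     x.2.2 4, x.2.2 5, x.2.2 6])

/-- The braid relation `(s₀s₂)³ = 1` for adjacent nodes of the `E₆⁽¹⁾` Dynkin
diagram, wherever all six successive applications are well defined. -/
theorem statement14 (q p : ℂ) (a : Fin 7 → ℂ)
    (h1 : (q, p, a).1 ≠ 0)
    (h2 : (s2E6 (q, p, a)).2.1 ≠ 0)
    (h3 : (s0E6 (s2E6 (q, p, a))).1 ≠ 0)
    (h4 : (s2E6 (s0E6 (s2E6 (q, p, a)))).2.1 ≠ 0)
    (h5 : (s0E6 (s2E6 (s0E6 (s2E6 (q, p, a))))).1 ≠ 0)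
    (h6 : (s2E6 (s0E6 (s2E6 (s0E6 (s2E6 (q, p, a)))))).2.1 ≠ 0) :
    s0E6 (s2E6 (s0E6 (s2E6 (s0E6 (s2E6 (q, p, a)))))) = (q, p, a) := by
  have e1 : q ≠ 0 := h1
  simp only [s0E6, s2E6, Matrix.cons_val] at h2 h3 h4 h5 h6 ⊢
  generalize hx : a 0 = x at *
  generalize hz : a 2 = z at *
  obtain ⟨p1, hp1⟩ : ∃ p1, p1 = p - z / q := ⟨_, rfl⟩
  have hz' : z = q * p - q * p1 := by rw [hp1]; field_simp; ring
  rw [← hp1] at h2 h3 h4 h5 h6 ⊢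
  have k3 : q + (x + z) / p1 = (q * p + x) / p1 := by
    rw [hz']; field_simp; ring
  rw [k3] at h3 h4 h5 h6 ⊢
  have n3 : q * p + x ≠ 0 := fun h => h3 (by rw [h, zero_div])
  have d4 : x + z + -z = x := by ring
  simp only [d4] at h4 h5 h6 ⊢
  have k4 : p1 - x / ((q * p + x) / p1) = q * p * p1 / (q * p + x) := by
    field_simp; ring
  rw [k4] at h4 h5 h6 ⊢
  have n4 : p ≠ 0 := by rintro rfl; simp at h4
  have k5 : (q * p + x) / p1 + (-(x + z) + x) / (q * p * p1 / (q * p + x)) = (q * p + x) / p := by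
    rw [hz']; field_simp; ring
  rw [k5] at h5 h6 ⊢
  have k6 : q * p * p1 / (q * p + x) - (-(x + z) + x + -x) / ((q * p + x) / p) = p := by
    rw [hz']; field_simp; ring
  rw [k6]
  refine Prod.ext ?_ (Prod.ext rfl ?_)
  · simp only
    field_simp; ring
  · funext i
    fin_cases i <;> simp [← hx, ← hz] <;> ring
end

section
/- Let α = (α0,α1,α2,α3,α4) ∈ ℂ^5 satisfy α0+α1+2α2+α3+α4 = 1, let J ⊆ ℝ∖{0,1} be an open interval, and let q,p : J → ℂ be differentiable with p(t) ≠ 0 for all t ∈ J, satisfying q'(t) = ∂G/∂p(q(t),p(t),t;α) and p'(t) = −∂G/∂q(q(t),p(t),t;α). Define Q(t) = −(q(t)·p(t) − α4)·p(t) and P(t) = 1/p(t). Then Q'(t) = ∂H_VI/∂p(Q(t),P(t),t;α) and P'(t) = −∂H_VI/∂q(Q(t),P(t),t;α) for all t ∈ J; that is, the birational symplectic transformation φ : (q,p) ↦ (−(qp−α4)p, 1/p) carries the G-system to the Painlevé VI Hamiltonian system with Hamiltonian H_VI. -/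
/-- The polynomial Hamiltonian `G(q,p,t;α)` equivalent to the Painlevé VI
Hamiltonian, characterized by holomorphy conditions. -/
noncomputable def hamG (a0 a1 a2 a3 a4 q p t : ℂ) : ℂ :=
  -(q^3 * p^4) / (t * (t - 1))
  - (a0 + a3 - 2*a4 - 1) * q^2 * p^3 / (t * (t - 1))
  - (t + 1) * q^2 * p^2 / (t * (t - 1))
  - (a1*a2 + a2^2 + 2*a4 - 2*a0*a4 - 2*a3*a4 + a4^2) * q * p^2 / (t * (t - 1))
  - ((a3 - a4) * t + a0 - a4 - 1) * q * p / (t * (t - 1))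
  - q / (t - 1)
  + a4 * (a2 + a4) * (a1 + a2 + a4) * p / (t * (t - 1))

/-- The partial derivative `∂G/∂p`. -/
noncomputable def hamGp (a0 a1 a2 a3 a4 q p t : ℂ) : ℂ :=
  deriv (fun x => hamG a0 a1 a2 a3 a4 q x t) p

/-- The partial derivative `∂G/∂q`. -/
noncomputable def hamGq (a0 a1 a2 a3 a4 q p t : ℂ) : ℂ :=
  deriv (fun x => hamG a0 a1 a2 a3 a4 x p t) q

/-- The Painlevé VI Hamiltonian `H_VI(q,p,t;α)`. -/
noncomputable def hamVI (a0 a1 a2 a3 a4 q p t : ℂ) : ℂ :=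
  (1 / (t * (t - 1))) *
    (p^2 * (q - t) * (q - 1) * q
     - ((a0 - 1) * (q - 1) * q + a3 * (q - t) * q + a4 * (q - t) * (q - 1)) * p
     + a2 * (a1 + a2) * (q - t))

/-- The partial derivative `∂H_VI/∂p`. -/
noncomputable def hamVIp (a0 a1 a2 a3 a4 q p t : ℂ) : ℂ :=
  deriv (fun x => hamVI a0 a1 a2 a3 a4 q x t) p

/-- The partial derivative `∂H_VI/∂q`. -/
noncomputable def hamVIq (a0 a1 a2 a3 a4 q p t : ℂ) : ℂ :=
  deriv (fun x => hamVI a0 a1 a2 a3 a4 x p t) q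

/-- Derivative of a quartic polynomial. -/
lemma deriv_quartic (f : ℂ → ℂ) (c4 c3 c2 c1 c0 y : ℂ)
    (hf : ∀ x, f x = c4 * x^4 + c3 * x^3 + c2 * x^2 + c1 * x + c0) :
    deriv f y = 4 * c4 * y^3 + 3 * c3 * y^2 + 2 * c2 * y + c1 := by
  have e : f = fun x => c4 * x^4 + c3 * x^3 + c2 * x^2 + c1 * x + c0 := funext hf
  rw [e]
  have h := (((((hasDerivAt_id y).pow 4).const_mul c4).add
    (((hasDerivAt_id y).pow 3).const_mul c3)).add
    (((hasDerivAt_id y).pow 2).const_mul c2)).add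
    ((hasDerivAt_id y).const_mul c1) |>.add_const c0
  have h2 := h.deriv
  simp only [id] at h2
  refine Eq.trans ?_ (h2.trans ?_)
  · rfl
  · push_cast
    ring

lemma hamGp_eq (a0 a1 a2 a3 a4 q p t : ℂ) : hamGp a0 a1 a2 a3 a4 q p t =
    (-(4 * q^3 * p^3) - 3 * (a0 + a3 - 2*a4 - 1) * q^2 * p^2 - 2 * (t + 1) * q^2 * p
      - 2 * (a1*a2 + a2^2 + 2*a4 - 2*a0*a4 - 2*a3*a4 + a4^2) * q * p
      - ((a3 - a4) * t + a0 - a4 - 1) * q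
      + a4 * (a2 + a4) * (a1 + a2 + a4)) / (t * (t - 1)) := by
  unfold hamGp
  rw [deriv_quartic _ (-(q^3) / (t * (t - 1)))
    (-(a0 + a3 - 2*a4 - 1) * q^2 / (t * (t - 1)))
    ((-(t + 1) * q^2 - (a1*a2 + a2^2 + 2*a4 - 2*a0*a4 - 2*a3*a4 + a4^2) * q) / (t * (t - 1)))
    ((-((a3 - a4) * t + a0 - a4 - 1) * q
      + a4 * (a2 + a4) * (a1 + a2 + a4)) / (t * (t - 1))) (-q / (t - 1))]
  · ring
  · intro x
    unfold hamG
    simp only [div_eq_mul_inv]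
    generalize (t * (t - 1))⁻¹ = d
    ring

lemma hamGq_eq (a0 a1 a2 a3 a4 q p t : ℂ) (ht : t ≠ 0) : hamGq a0 a1 a2 a3 a4 q p t =
    (-(3 * q^2 * p^4) - 2 * (a0 + a3 - 2*a4 - 1) * q * p^3 - 2 * (t + 1) * q * p^2
      - (a1*a2 + a2^2 + 2*a4 - 2*a0*a4 - 2*a3*a4 + a4^2) * p^2
      - ((a3 - a4) * t + a0 - a4 - 1) * p - t) / (t * (t - 1)) := by
  have e : 1 / (t - 1) = t / (t * (t - 1)) := by
    rw [div_mul_eq_div_div, div_self ht]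
  unfold hamGq
  rw [deriv_quartic _ 0 (-(p^4) / (t * (t - 1)))
    ((-(a0 + a3 - 2*a4 - 1) * p^3 - (t + 1) * p^2) / (t * (t - 1)))
    ((-(a1*a2 + a2^2 + 2*a4 - 2*a0*a4 - 2*a3*a4 + a4^2) * p^2
      - ((a3 - a4) * t + a0 - a4 - 1) * p - t) / (t * (t - 1)))
    (a4 * (a2 + a4) * (a1 + a2 + a4) * p / (t * (t - 1)))]
  · ring
  · intro x
    unfold hamG
    have e2 : x / (t - 1) = x * (t / (t * (t - 1))) := by rw [← e]; ring
    rw [e2]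
    simp only [div_eq_mul_inv]
    generalize (t * (t - 1))⁻¹ = d
    ring

lemma hamVIp_eq (a0 a1 a2 a3 a4 q p t : ℂ) : hamVIp a0 a1 a2 a3 a4 q p t =
    (2 * p * (q - t) * (q - 1) * q
     - ((a0 - 1) * (q - 1) * q + a3 * (q - t) * q + a4 * (q - t) * (q - 1)))
      / (t * (t - 1)) := by
  unfold hamVIp
  rw [deriv_quartic _ 0 0 ((q - t) * (q - 1) * q / (t * (t - 1)))
    (-((a0 - 1) * (q - 1) * q + a3 * (q - t) * q + a4 * (q - t) * (q - 1)) / (t * (t - 1)))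
    (a2 * (a1 + a2) * (q - t) / (t * (t - 1)))]
  · ring
  · intro x
    unfold hamVI
    simp only [div_eq_mul_inv]
    generalize (t * (t - 1))⁻¹ = d
    ring

lemma hamVIq_eq (a0 a1 a2 a3 a4 q p t : ℂ) : hamVIq a0 a1 a2 a3 a4 q p t =
    (p^2 * (3 * q^2 - 2 * (t + 1) * q + t)
     - ((a0 - 1) * (2 * q - 1) + a3 * (2 * q - t) + a4 * (2 * q - t - 1)) * p
     + a2 * (a1 + a2)) / (t * (t - 1)) := by
  unfold hamVIq
  rw [deriv_quartic _ 0 (p^2 / (t * (t - 1)))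
    ((-(p^2 * (t + 1)) - (a0 - 1 + a3 + a4) * p) / (t * (t - 1)))
    ((p^2 * t + (a0 - 1 + a3 * t + a4 * (t + 1)) * p + a2 * (a1 + a2)) / (t * (t - 1)))
    ((-(a4 * t * p) - a2 * (a1 + a2) * t) / (t * (t - 1)))]
  · ring
  · intro x
    unfold hamVI
    simp only [div_eq_mul_inv]
    generalize (t * (t - 1))⁻¹ = d
    ring

/-- The birational symplectic transformation `φ : (q,p) ↦ (-(qp-α₄)p, 1/p)`
carries the `G`-system to the Painlevé VI Hamiltonian system. -/
theorem statement15 (a0 a1 a2 a3 a4 : ℂ)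
    (hα : a0 + a1 + 2*a2 + a3 + a4 = 1)
    (aa bb : ℝ) (hJ : Set.Ioo aa bb ⊆ {t : ℝ | t ≠ 0 ∧ t ≠ 1})
    (q p : ℝ → ℂ) (hp0 : ∀ t ∈ Set.Ioo aa bb, p t ≠ 0)
    (hq : ∀ t ∈ Set.Ioo aa bb,
      HasDerivAt q (hamGp a0 a1 a2 a3 a4 (q t) (p t) (t : ℂ)) t)
    (hp : ∀ t ∈ Set.Ioo aa bb,
      HasDerivAt p (-(hamGq a0 a1 a2 a3 a4 (q t) (p t) (t : ℂ))) t) :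
    ∀ t ∈ Set.Ioo aa bb,
      HasDerivAt (fun s : ℝ => -(q s * p s - a4) * p s)
        (hamVIp a0 a1 a2 a3 a4
          (-(q t * p t - a4) * p t) (1 / p t) (t : ℂ)) t ∧
      HasDerivAt (fun s : ℝ => 1 / p s)
        (-(hamVIq a0 a1 a2 a3 a4
          (-(q t * p t - a4) * p t) (1 / p t) (t : ℂ))) t := by
  intro t ht
  have hpt := hp0 t ht
  have ht0 : (t : ℂ) ≠ 0 := by exact_mod_cast (hJ ht).1
  have ht1 : (t : ℂ) - 1 ≠ 0 := by
    rw [sub_ne_zero]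
    exact_mod_cast (hJ ht).2
  have hq' := hq t ht
  have hp' := hp t ht
  rw [hamGp_eq] at hq'
  rw [hamGq_eq _ _ _ _ _ _ _ _ ht0] at hp'
  rw [hamVIp_eq, hamVIq_eq]
  have h0 : a0 = 1 - a1 - 2*a2 - a3 - a4 := by linear_combination hα
  constructor
  · have h := (((hq'.mul hp').sub_const a4).neg).mul hp'
    refine HasDerivAt.congr_deriv h ?_
    simp only [Pi.mul_apply, Pi.neg_apply]
    subst h0
    field_simp
    ring
  · have h := hp'.inv hpt
    simp only [one_div]
    refine HasDerivAt.congr_deriv h ?_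
    field_simp
    ring
end

section
/- Let α = (α0,α1,α2,α3,α4) ∈ ℂ^5 satisfy α0+α1+2α2+α3+α4 = 1. Then for all q,p ∈ ℂ and all t ∈ ℂ∖{0,1} the Hamiltonian G satisfies G(q,p,t; w1(α)) = G(q,p,t;α) and G(q,p,t; w2(α)) = G(q,p,t;α), where w1(α) = (α0, −α1, α2+α1, α3, α4) and w2(α) = (α0+α2, α1+α2, −α2, α3+α2, α4+α2). In particular w1 and w2 are Bäcklund transformations of the Hamiltonian system dq/dt = ∂G/∂p, dp/dt = −∂G/∂q, fixing (q,p) and acting only on the parameters. -/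
/-- The parameter transformations `w₁, w₂` leave the Hamiltonian `G` invariant;
in particular they are Bäcklund transformations of the `G`-system fixing
`(q,p)` and acting only on the parameters. -/
theorem statement19 (a0 a1 a2 a3 a4 : ℂ)
    (hα : a0 + a1 + 2*a2 + a3 + a4 = 1) :
    ∀ q p : ℂ, ∀ t : ℂ, t ≠ 0 → t ≠ 1 →
      hamG a0 (-a1) (a2 + a1) a3 a4 q p t = hamG a0 a1 a2 a3 a4 q p t ∧
      hamG (a0 + a2) (a1 + a2) (-a2) (a3 + a2) (a4 + a2) q p t
        = hamG a0 a1 a2 a3 a4 q p t := by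
  intro q p t _ _
  have h0 : a0 = 1 - a1 - 2*a2 - a3 - a4 := by linear_combination hα
  subst h0
  unfold hamG
  constructor <;> ring
end
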